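/- Let n ≥ 3 and let g be an element of GL(n-1, ℤ), acting on ℤ^(n-1) with standard basis e₁, …, e_(n-1). Let π : ℤ^(n-1) → ℤ denote the projection onto the first coordinate. Then gcd(π(g(e₂)), …, π(g(e_(n-1)))) = gcd(π(g⁻¹(e₂)), …, π(g⁻¹(e_(n-1)))), where gcd of the all-zero family is taken to be 0. -/

import Mathlib

/-- If `d` divides the `k`-th coordinates of all `f eᵢ` with `i ≠ k`, then the `k`-th coordinate
of `f v` is congruent to `v k * f eₖ k` modulo `d`. -/
theorem dvd_apply_sub_mul_of_dvd_single {ι R : Type*} [Fintype ι] [DecidableEq ι] [CommRing R]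
    (f : (ι → R) →ₗ[R] (ι → R)) {k : ι} {d : R}
    (hd : ∀ i, i ≠ k → d ∣ f (Pi.single i 1) k) (v : ι → R) :
    d ∣ f v k - v k * f (Pi.single k 1) k := by
  have hv : f v k = ∑ i, v i * f (Pi.single i 1) k := by
    conv_lhs => rw [pi_eq_sum_univ' v, map_sum]
    simp [Finset.sum_apply]
  rw [hv, ← Finset.add_sum_erase _ _ (Finset.mem_univ k), add_sub_cancel_left]
  exact Finset.dvd_sum fun i hi => (hd i (Finset.ne_of_mem_erase hi)).mul_left _

/-- A common divisor of the off-diagonal entries in the `k`-th row of an invertible matrix divides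
the off-diagonal entries in the `k`-th row of its inverse. -/
theorem dvd_symm_single_of_dvd_single {ι R : Type*} [Fintype ι] [DecidableEq ι] [CommRing R]
    (g : (ι → R) ≃ₗ[R] (ι → R)) {k : ι} {d : R}
    (hd : ∀ i, i ≠ k → d ∣ g (Pi.single i 1) k) {j : ι} (hj : j ≠ k) :
    d ∣ g.symm (Pi.single j 1) k := by
  have key (l : ι) := dvd_apply_sub_mul_of_dvd_single g.toLinearMap hd (g.symm (Pi.single l 1))
  obtain ⟨x, hx⟩ := key j
  obtain ⟨y, hy⟩ := key k
  simp only [LinearEquiv.coe_coe, LinearEquiv.apply_symm_apply, Pi.single_eq_same,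
    Pi.single_eq_of_ne hj.symm] at hx hy
  exact ⟨g.symm (Pi.single j 1) k * y - g.symm (Pi.single k 1) k * x, by
    linear_combination g.symm (Pi.single j 1) k * hy - g.symm (Pi.single k 1) k * hx⟩

/-- For `n ≥ 3` and `g ∈ GL(n-1, ℤ)` acting on `ℤ^(n-1)` with standard
basis `e₁, …, e_(n-1)`, letting `π` be the projection onto the first coordinate,
`gcd(π(g(e₂)), …, π(g(e_(n-1)))) = gcd(π(g⁻¹(e₂)), …, π(g⁻¹(e_(n-1))))`,
where the gcd of the all-zero family is `0`. -/
theorem stmt1 (n : ℕ) (hn : 3 ≤ n)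
    (g : (Fin (n - 1) → ℤ) ≃ₗ[ℤ] (Fin (n - 1) → ℤ)) :
    (Finset.univ.filter (fun i : Fin (n - 1) => i ≠ ⟨0, by omega⟩)).gcd
        (fun i => g (Pi.single i 1) ⟨0, by omega⟩) =
    (Finset.univ.filter (fun i : Fin (n - 1) => i ≠ ⟨0, by omega⟩)).gcd
        (fun i => g.symm (Pi.single i 1) ⟨0, by omega⟩) := by
  refine dvd_antisymm_of_normalize_eq Finset.normalize_gcd Finset.normalize_gcd
    (Finset.dvd_gcd fun j hj => ?_) (Finset.dvd_gcd fun j hj => ?_)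
  · exact dvd_symm_single_of_dvd_single g
      (fun i hi => Finset.gcd_dvd (by simpa using hi)) (Finset.mem_filter.mp hj).2
  · exact dvd_symm_single_of_dvd_single g.symm
      (fun i hi => Finset.gcd_dvd (f := fun i => g.symm (Pi.single i 1) _) (by simpa using hi))
      (Finset.mem_filter.mp hj).2
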